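/- Let ⟨·,·⟩_u and ⟨·,·⟩_{û} = ⟨·,·⟩_u + ⟨·,·⟩_v be two nondegenerate sesquilinear forms on p×p matrix polynomials with monic biorthogonal families {P^{[i]}_n} (for u, with matrices H_n) and {P̂^{[i]}_n} (for û, with matrices Ĥ_n). Then P̂^{[1]}_n(z) = P^{[1]}_n(z) − ⟨P̂^{[1]}_n(x), (K_{n−1}(z,y))ᵀ⟩_v, where K_{n−1} is the Christoffel–Darboux kernel of u. -/

import Mathlib

open Polynomial Matrix Finset

namespace Paper

abbrev Mat (p : ℕ) := Matrix (Fin p) (Fin p) ℂ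
abbrev MatPoly (p : ℕ) := Matrix (Fin p) (Fin p) (Polynomial ℂ)

variable {p : ℕ}

/-- Embed a constant matrix as a matrix polynomial. -/
noncomputable def cm (A : Mat p) : MatPoly p := A.map Polynomial.C

/-- The monomial `I_p x^k` as a matrix polynomial. -/
noncomputable def monoM (p k : ℕ) : MatPoly p := Matrix.diagonal (fun _ => (Polynomial.X : Polynomial ℂ) ^ k)

/-- The `k`-th matrix coefficient of a matrix polynomial. -/
noncomputable def coeffM (P : MatPoly p) (k : ℕ) : Mat p := Matrix.of fun i j => (P i j).coeff k

/-- Entrywise derivative of a matrix polynomial. -/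
noncomputable def dM : MatPoly p → MatPoly p := fun P => Matrix.of fun i j => Polynomial.derivative (P i j)

/-- Evaluation of a matrix polynomial at a scalar point. -/
noncomputable def evM (z : ℂ) (P : MatPoly p) : Mat p := Matrix.of fun i j => (P i j).eval z

/-- `P` is monic of exact degree `n`. -/
def MonicDeg (P : MatPoly p) (n : ℕ) : Prop :=
  coeffM P n = 1 ∧ ∀ k, n < k → coeffM P k = 0

/-- Sesquilinear form on matrix polynomials: left `ℂ^{p×p}`-linear in the first slot,
`⟨P, AQ + R⟩ = ⟨P,Q⟩Aᵀ + ⟨P,R⟩` in the second slot. -/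
def IsSesq (S : MatPoly p → MatPoly p → Mat p) : Prop :=
  (∀ (A : Mat p) (P Q R : MatPoly p), S (cm A * P + Q) R = A * S P R + S Q R) ∧
  (∀ (A : Mat p) (P Q R : MatPoly p), S P (cm A * Q + R) = S P Q * Aᵀ + S P R)

end Paper

namespace Paper

variable {p : ℕ}

theorem coeffM_sub (P Q : MatPoly p) (k : ℕ) :
    coeffM (P - Q) k = coeffM P k - coeffM Q k := by
  ext i j
  simp [coeffM]

theorem coeffM_cm_mul (A : Mat p) (P : MatPoly p) (k : ℕ) :
    coeffM (cm A * P) k = A * coeffM P k := by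
  ext i j
  simp [coeffM, cm, Matrix.mul_apply]

theorem cm_one : cm (1 : Mat p) = 1 := by
  simp [cm]

theorem cm_neg (A : Mat p) : cm (-A) = -cm A := by
  ext i j
  simp [cm]

/-- A matrix polynomial of degree less than `n` expands in any family of monic matrix
polynomials of degrees `0, …, n - 1`. -/
theorem exists_expansion (P : ℕ → MatPoly p) (hP : ∀ k, MonicDeg (P k) k) (n : ℕ)
    (Q : MatPoly p) (hQ : ∀ k, n ≤ k → coeffM Q k = 0) :
    ∃ c : ℕ → Mat p, Q = ∑ k ∈ Finset.range n, cm (c k) * P k := by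
  induction n generalizing Q with
  | zero =>
    refine ⟨0, ?_⟩
    ext i j k
    simpa [coeffM] using congrFun (congrFun (hQ k k.zero_le) i) j
  | succ n ih =>
    obtain ⟨c, hc⟩ := ih (Q - cm (coeffM Q n) * P n) fun k hk => by
      rw [coeffM_sub, coeffM_cm_mul]
      rcases hk.eq_or_lt with rfl | hlt
      · rw [(hP n).1, mul_one, sub_self]
      · rw [hQ k hlt, (hP n).2 k hlt, mul_zero, sub_zero]
    refine ⟨Function.update c n (coeffM Q n), ?_⟩
    rw [Finset.sum_range_succ, Function.update_self, ← sub_eq_iff_eq_add, hc]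
    refine Finset.sum_congr rfl fun k hk => ?_
    rw [Function.update_of_ne (Finset.mem_range.1 hk).ne]

namespace IsSesq

variable {S : MatPoly p → MatPoly p → Mat p}

theorem add_left (hS : IsSesq S) (P Q R : MatPoly p) : S (P + Q) R = S P R + S Q R := by
  simpa [cm_one] using hS.1 1 P Q R

theorem zero_left (hS : IsSesq S) (R : MatPoly p) : S 0 R = 0 := by
  simpa using hS.add_left 0 0 R

theorem zero_right (hS : IsSesq S) (P : MatPoly p) : S P 0 = 0 := by
  simpa [cm_one] using hS.2 1 P 0 0

theorem sum_left (hS : IsSesq S) (s : Finset ℕ) (c : ℕ → Mat p) (P : ℕ → MatPoly p)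
    (R : MatPoly p) : S (∑ k ∈ s, cm (c k) * P k) R = ∑ k ∈ s, c k * S (P k) R := by
  induction s using Finset.induction_on with
  | empty => simp [hS.zero_left]
  | insert a s ha ih => rw [Finset.sum_insert ha, Finset.sum_insert ha, hS.1, ih]

theorem sum_right (hS : IsSesq S) (s : Finset ℕ) (c : ℕ → Mat p) (P : MatPoly p)
    (R : ℕ → MatPoly p) : S P (∑ k ∈ s, cm (c k) * R k) = ∑ k ∈ s, S P (R k) * (c k)ᵀ := by
  induction s using Finset.induction_on with
  | empty => simp [hS.zero_right]
  | insert a s ha ih => rw [Finset.sum_insert ha, Finset.sum_insert ha, hS.2, ih]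

end IsSesq

end Paper

open Paper in
/-- For the additive perturbation `û = u + v` (`v := û − u`),
`P̂^{[1]}_n(z) = P^{[1]}_n(z) − ⟨P̂^{[1]}_n(x), (K_{n−1}(z,y))ᵀ⟩_v`, the pairing with the
transposed CD kernel of `u` being expanded via the sesquilinearity of the form. -/
theorem statement4 (p : ℕ) (u uh : MatPoly p → MatPoly p → Mat p)
    (hu : IsSesq u) (huh : IsSesq uh)
    (P1 P2 hP1 hP2 : ℕ → MatPoly p) (H Hh : ℕ → Mat p)
    (hmon1 : ∀ k, MonicDeg (P1 k) k) (hmon2 : ∀ k, MonicDeg (P2 k) k)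
    (hmon1h : ∀ k, MonicDeg (hP1 k) k) (hmon2h : ∀ k, MonicDeg (hP2 k) k)
    (hH : ∀ k, IsUnit (H k)) (hHh : ∀ k, IsUnit (Hh k))
    (hbio : ∀ k l, u (P1 k) (P2 l) = if k = l then H k else 0)
    (hbioh : ∀ k l, uh (hP1 k) (hP2 l) = if k = l then Hh k else 0)
    (n : ℕ) :
    hP1 n = P1 n
      - ∑ k ∈ Finset.range n,
          cm ((uh (hP1 n) (P2 k) - u (hP1 n) (P2 k)) * (H k)⁻¹) * P1 k := by
  have orth : ∀ k ∈ Finset.range n, uh (hP1 n) (P2 k) = 0 := fun k hk => by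
    have hkn := Finset.mem_range.1 hk
    obtain ⟨c, hc⟩ := exists_expansion hP2 hmon2h n (P2 k)
      fun j hj => (hmon2 k).2 j (hkn.trans_le hj)
    rw [hc, huh.sum_right]
    refine Finset.sum_eq_zero fun j hj => ?_
    rw [hbioh, if_neg (Finset.mem_range.1 hj).ne', zero_mul]
  obtain ⟨c, hc⟩ := exists_expansion P1 hmon1 n (hP1 n - P1 n) fun k hk => by
    rw [coeffM_sub]
    rcases hk.eq_or_lt with rfl | hlt
    · rw [(hmon1h n).1, (hmon1 n).1, sub_self]
    · rw [(hmon1h n).2 k hlt, (hmon1 n).2 k hlt, sub_self]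
  have hsum : hP1 n = ∑ k ∈ Finset.range n, cm (c k) * P1 k + P1 n := eq_add_of_sub_eq hc
  have coeff : ∀ k ∈ Finset.range n,
      (uh (hP1 n) (P2 k) - u (hP1 n) (P2 k)) * (H k)⁻¹ = -c k := fun k hk => by
    have hu_k : u (hP1 n) (P2 k) = c k * H k := by
      rw [hsum, hu.add_left, hu.sum_left, hbio n k, if_neg (Finset.mem_range.1 hk).ne',
        add_zero, Finset.sum_eq_single_of_mem k hk, hbio, if_pos rfl]
      intro j _ hj
      rw [hbio, if_neg hj, mul_zero]
    rw [orth k hk, hu_k, zero_sub, neg_mul,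
      Matrix.mul_nonsing_inv_cancel_right _ _ ((Matrix.isUnit_iff_isUnit_det _).1 (hH k))]
  have hneg : ∑ k ∈ Finset.range n,
      cm ((uh (hP1 n) (P2 k) - u (hP1 n) (P2 k)) * (H k)⁻¹) * P1 k =
      -∑ k ∈ Finset.range n, cm (c k) * P1 k := by
    rw [← Finset.sum_neg_distrib]
    refine Finset.sum_congr rfl fun k hk => ?_
    rw [coeff k hk, cm_neg, neg_mul]
  rw [hneg, sub_neg_eq_add, add_comm]
  exact hsum
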